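/- arXiv:1708.02615 — 7 statements merged into one kernel-verified Lean document; each statement's English description precedes it below -/
import Mathlib

section
/- Let θ₁, θ₂ ∈ ℝ be irrational. Then the following are equivalent: (i) there exists a nonzero real number θ such that for all nonzero complex numbers x, x', y, y' with C_θ(x, y) and C_θ(x', y'), one has x'/x ∈ Γ_{θ₁} if and only if y'/y ∈ Γ_{θ₂} (i.e., the relation C_θ induces a well-defined bijection between the cosets of Γ_{θ₁} and the cosets of Γ_{θ₂} in ℂ*); (ii) there exist integers a, b, c, d with |ad − bc| = 1 such that θ₂ = (a·θ₁ + b)/(c·θ₁ + d). -/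
/-- The multivalued relation `y = x^θ`: there is `z` with `x = exp z` and `y = exp (θ z)`. -/
def Crel (θ : ℝ) (x y : ℂ) : Prop :=
  ∃ z : ℂ, x = Complex.exp z ∧ y = Complex.exp ((θ : ℂ) * z)

/-- `exp(2 π i α)`. -/
noncomputable def qexp (α : ℝ) : ℂ := Complex.exp (2 * (Real.pi : ℂ) * Complex.I * (α : ℝ))

/-- The cyclic subgroup `Γ_α = {exp(2πiα)^n : n ∈ ℤ}` of `ℂ*`. -/
def Gam (α : ℝ) : Set ℂ := {w : ℂ | ∃ n : ℤ, w = qexp α ^ n}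

/-- The additive subgroup `ℤ θ + ℤ = {m θ + n : m, n ∈ ℤ}` of `ℝ`. -/
def Zlat (θ : ℝ) : Set ℝ := {x : ℝ | ∃ m n : ℤ, x = (m : ℝ) * θ + (n : ℝ)}

theorem exp_mem_Gam_iff (α : ℝ) (w : ℂ) :
    Complex.exp w ∈ Gam α ↔ ∃ r ∈ Zlat α, w = 2 * (Real.pi : ℂ) * Complex.I * (r : ℝ) := by
  simp only [Gam, qexp, Zlat, Set.mem_ofPred_eq, ← Complex.exp_int_mul,
    Complex.exp_eq_exp_iff_exists_int]
  constructor
  · rintro ⟨m, n, h⟩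
    refine ⟨m * α + n, ⟨m, n, rfl⟩, ?_⟩
    rw [h]
    push_cast
    ring
  · rintro ⟨_, ⟨m, n, rfl⟩, h⟩
    refine ⟨m, n, ?_⟩
    rw [h]
    push_cast
    ring

/-- `C_θ` is compatible with the cosets of `Γ_α` and `Γ_β` iff multiplication by `θ` matches
the lattices `ℤ α + ℤ` and `ℤ β + ℤ`. -/
theorem Crel_compatible_iff {θ : ℝ} (hθ : θ ≠ 0) (α β : ℝ) :
    (∀ x x' y y' : ℂ, x ≠ 0 → x' ≠ 0 → y ≠ 0 → y' ≠ 0 →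
        Crel θ x y → Crel θ x' y' → (x' / x ∈ Gam α ↔ y' / y ∈ Gam β)) ↔
      ∀ r : ℝ, r ∈ Zlat α ↔ θ * r ∈ Zlat β := by
  have hθ' : (θ : ℂ) ≠ 0 := by exact_mod_cast hθ
  have hpi : 2 * (Real.pi : ℂ) * Complex.I ≠ 0 := Complex.two_pi_I_ne_zero
  have mem_iff (γ r : ℝ) :
      Complex.exp (2 * (Real.pi : ℂ) * Complex.I * (r : ℝ)) ∈ Gam γ ↔ r ∈ Zlat γ := by
    rw [exp_mem_Gam_iff]
    constructor
    · rintro ⟨s, hs, h⟩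
      have : r = s := by exact_mod_cast mul_left_cancel₀ hpi h
      rwa [this]
    · exact fun h => ⟨r, h, rfl⟩
  constructor
  · intro h r
    have key := h 1 (Complex.exp (2 * (Real.pi : ℂ) * Complex.I * (r : ℝ))) 1
      (Complex.exp (2 * (Real.pi : ℂ) * Complex.I * ((θ * r : ℝ) : ℂ)))
      one_ne_zero (Complex.exp_ne_zero _) one_ne_zero (Complex.exp_ne_zero _)
      ⟨0, by simp, by simp⟩ ⟨_, rfl, by congr 1; push_cast; ring⟩
    rwa [div_one, div_one, mem_iff, mem_iff] at key
  · rintro h _ _ _ _ - - - - ⟨z, rfl, rfl⟩ ⟨z', rfl, rfl⟩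
    rw [← Complex.exp_sub, ← Complex.exp_sub, ← mul_sub, exp_mem_Gam_iff, exp_mem_Gam_iff]
    constructor
    · rintro ⟨r, hr, hz⟩
      refine ⟨θ * r, (h r).1 hr, ?_⟩
      rw [hz]
      push_cast
      ring
    · rintro ⟨s, hs, hz⟩
      refine ⟨s / θ, (h _).2 (by rwa [mul_div_cancel₀ _ hθ]), mul_left_cancel₀ hθ' ?_⟩
      rw [hz]
      push_cast
      field_simp

theorem Irrational.int_mul_add_int_eq_zero {α : ℝ} (h : Irrational α) {m n : ℤ}
    (e : (m : ℝ) * α + n = 0) : m = 0 ∧ n = 0 := by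
  have hm : m = 0 := by
    by_contra hm
    exact ((h.intCast_mul hm).add_intCast n).ne_zero e
  subst hm
  simpa using e

theorem stmt0 (θ₁ θ₂ : ℝ) (h1 : Irrational θ₁) (h2 : Irrational θ₂) :
    (∃ θ : ℝ, θ ≠ 0 ∧ ∀ x x' y y' : ℂ, x ≠ 0 → x' ≠ 0 → y ≠ 0 → y' ≠ 0 →
        Crel θ x y → Crel θ x' y' → (x' / x ∈ Gam θ₁ ↔ y' / y ∈ Gam θ₂)) ↔
    (∃ a b c d : ℤ, |a * d - b * c| = 1 ∧
        θ₂ = ((a : ℝ) * θ₁ + (b : ℝ)) / ((c : ℝ) * θ₁ + (d : ℝ))) := by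
  constructor
  · rintro ⟨θ, hθ, h⟩
    rw [Crel_compatible_iff hθ] at h
    obtain ⟨p, q, hpq⟩ := (h 1).1 ⟨0, 1, by simp⟩
    obtain ⟨r, s, hrs⟩ := (h θ₁).1 ⟨1, 0, by simp⟩
    obtain ⟨a, b, hab⟩ := (h (θ₂ / θ)).2 ⟨1, 0, by field_simp; simp⟩
    obtain ⟨c, d, hcd⟩ := (h (1 / θ)).2 ⟨0, 1, by field_simp; simp⟩
    rw [mul_one] at hpq
    have hab' : θ₂ = a * (θ * θ₁) + b * θ := by
      rw [div_eq_iff hθ] at hab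
      linear_combination hab
    have hcd' : 1 = c * (θ * θ₁) + d * θ := by
      rw [div_eq_iff hθ] at hcd
      linear_combination hcd
    obtain ⟨e₁, e₂⟩ := h2.int_mul_add_int_eq_zero (m := a * r + b * p - 1) (n := a * s + b * q)
      (by push_cast; linear_combination -hab' - a * hrs - b * hpq)
    obtain ⟨e₃, e₄⟩ := h2.int_mul_add_int_eq_zero (m := c * r + d * p) (n := c * s + d * q - 1)
      (by push_cast; linear_combination -hcd' - c * hrs - d * hpq)
    refine ⟨a, b, c, d, ?_, ?_⟩
    · refine Int.isUnit_iff_abs_eq.1 (IsUnit.of_mul_eq_one (r * q - s * p) ?_)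
      linear_combination (c * s + d * q) * e₁ + e₄ - (c * r + d * p) * e₂
    · rw [← hab, ← hcd]
      field_simp
  · rintro ⟨a, b, c, d, hdet, h⟩
    have hD : (c : ℝ) * θ₁ + d ≠ 0 := by
      intro h0
      obtain ⟨rfl, rfl⟩ := h1.int_mul_add_int_eq_zero h0
      simp at hdet
    have hsq : ((a : ℝ) * d - b * c) ^ 2 = 1 := by
      have := congrArg (· ^ 2) hdet
      simp only [sq_abs, one_pow] at this
      exact_mod_cast this
    rw [eq_div_iff hD] at h
    refine ⟨((c : ℝ) * θ₁ + d)⁻¹, inv_ne_zero hD, ?_⟩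
    rw [Crel_compatible_iff (inv_ne_zero hD)]
    intro r
    constructor
    · rintro ⟨m, n, rfl⟩
      refine ⟨(a * d - b * c) * (m * d - n * c), (a * d - b * c) * (n * a - m * b), ?_⟩
      rw [inv_mul_eq_iff_eq_mul₀ hD]
      push_cast
      linear_combination (-(m * θ₁ + n)) * hsq - ((a : ℝ) * d - b * c) * (m * d - n * c) * h
    · rintro ⟨m, n, e⟩
      rw [inv_mul_eq_iff_eq_mul₀ hD] at e
      refine ⟨m * a + n * c, m * b + n * d, ?_⟩
      push_cast
      linear_combination e + m * h
end

section
/- Let θ₁, θ₂ ∈ ℝ be irrational. Then there exists a nonzero real number θ such that θ·(ℤθ₁ + ℤ) = ℤθ₂ + ℤ (equality of subsets of ℝ, where θ·S = {θs : s ∈ S}) if and only if there exist integers a, b, c, d with |ad − bc| = 1 and θ₂ = (a·θ₁ + b)/(c·θ₁ + d). -/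
theorem Irrational.int_mul_add_inj {x : ℝ} (hx : Irrational x) {m n m' n' : ℤ}
    (h : (m : ℝ) * x + n = m' * x + n') : m = m' ∧ n = n' := by
  have hm : m = m' := by
    by_contra hne
    have hsub : m - m' ≠ 0 := sub_ne_zero.mpr hne
    refine ((hx.intCast_mul hsub).add_intCast (n - n')).ne_zero ?_
    push_cast
    linarith
  subst hm
  exact ⟨rfl, by exact_mod_cast add_left_cancel h⟩

theorem stmt1 (θ₁ θ₂ : ℝ) (h1 : Irrational θ₁) (h2 : Irrational θ₂) :
    (∃ θ : ℝ, θ ≠ 0 ∧ (fun s : ℝ => θ * s) '' Zlat θ₁ = Zlat θ₂) ↔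
    (∃ a b c d : ℤ, |a * d - b * c| = 1 ∧
        θ₂ = ((a : ℝ) * θ₁ + (b : ℝ)) / ((c : ℝ) * θ₁ + (d : ℝ))) := by
  constructor
  · rintro ⟨θ, -, h⟩
    obtain ⟨p, q, hpq⟩ : θ * θ₁ ∈ Zlat θ₂ := h ▸ ⟨θ₁, ⟨1, 0, by simp⟩, rfl⟩
    obtain ⟨r, s, hrs⟩ : θ * 1 ∈ Zlat θ₂ := h ▸ ⟨1, ⟨0, 1, by simp⟩, rfl⟩
    obtain ⟨_, ⟨a, b, rfl⟩, hab⟩ : θ₂ ∈ (fun s : ℝ => θ * s) '' Zlat θ₁ :=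
      h ▸ ⟨1, 0, by simp⟩
    obtain ⟨_, ⟨c, d, rfl⟩, hcd⟩ : (1 : ℝ) ∈ (fun s : ℝ => θ * s) '' Zlat θ₁ :=
      h ▸ ⟨0, 1, by simp⟩
    dsimp only at hab hcd
    obtain ⟨e₁, e₂⟩ := h2.int_mul_add_inj (m := a * p + b * r) (n := a * q + b * s)
      (m' := 1) (n' := 0) (by push_cast; linear_combination hab - a * hpq - b * hrs)
    obtain ⟨e₃, e₄⟩ := h2.int_mul_add_inj (m := c * p + d * r) (n := c * q + d * s)
      (m' := 0) (n' := 1) (by push_cast; linear_combination hcd - c * hpq - d * hrs)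
    refine ⟨a, b, c, d, ?_, ?_⟩
    · refine Int.isUnit_iff_abs_eq.mp (IsUnit.of_mul_eq_one (p * s - q * r) ?_)
      linear_combination (c * q + d * s) * e₁ + e₄ - (c * p + d * r) * e₂
    · have hne : (c : ℝ) * θ₁ + d ≠ 0 := right_ne_zero_of_mul_eq_one hcd
      rw [eq_div_iff hne]
      linear_combination (a * θ₁ + b) * hcd - (c * θ₁ + d) * hab
  · rintro ⟨a, b, c, d, hdet, hθ⟩
    have hne : (c : ℝ) * θ₁ + d ≠ 0 := fun h0 => h2.ne_zero (by rw [hθ, h0, div_zero])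
    have hsq : ((a : ℝ) * d - b * c) ^ 2 = 1 := by
      have := congrArg (· ^ 2) hdet
      simp only [sq_abs, one_pow] at this
      exact_mod_cast this
    rw [eq_div_iff hne] at hθ
    refine ⟨((c : ℝ) * θ₁ + d)⁻¹, inv_ne_zero hne, Set.Subset.antisymm ?_ ?_⟩
    · rintro _ ⟨_, ⟨m, n, rfl⟩, rfl⟩
      refine ⟨(a * d - b * c) * (m * d - n * c), (a * d - b * c) * (n * a - m * b), ?_⟩
      dsimp only
      rw [inv_mul_eq_iff_eq_mul₀ hne]
      push_cast
      linear_combination (-(m * θ₁ + n)) * hsq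
        - ((a : ℝ) * d - b * c) * (m * d - n * c) * hθ
    · rintro _ ⟨m, n, rfl⟩
      refine ⟨_, ⟨m * a + n * c, m * b + n * d, rfl⟩, ?_⟩
      dsimp only
      rw [inv_mul_eq_iff_eq_mul₀ hne]
      push_cast
      linear_combination (-m) * hθ
end

section
/- Let θ₁, θ₂, θ ∈ ℝ and suppose θ·θ₁ ∈ ℤθ₂ + ℤ and θ ∈ ℤθ₂ + ℤ. Then C_θ sends each coset of Γ_{θ₁} into a single coset of Γ_{θ₂}: for all nonzero complex numbers x, x', y, y', if x'/x ∈ Γ_{θ₁}, C_θ(x, y) and C_θ(x', y'), then y'/y ∈ Γ_{θ₂}. -/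
theorem stmt3 (θ₁ θ₂ θ : ℝ) (h1 : θ * θ₁ ∈ Zlat θ₂) (h2 : θ ∈ Zlat θ₂) :
    ∀ x x' y y' : ℂ, x ≠ 0 → x' ≠ 0 → y ≠ 0 → y' ≠ 0 →
      x' / x ∈ Gam θ₁ → Crel θ x y → Crel θ x' y' → y' / y ∈ Gam θ₂ := by
  rintro x x' y y' - - - - ⟨n, hn⟩ ⟨z, rfl, rfl⟩ ⟨z', rfl, rfl⟩
  obtain ⟨a, b, hab⟩ := h1
  obtain ⟨c, d, hcd⟩ := h2
  rw [qexp, ← Complex.exp_sub, ← Complex.exp_int_mul, Complex.exp_eq_exp_iff_exists_int] at hn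
  obtain ⟨k, hk⟩ := hn
  have hab' : (θ : ℂ) * θ₁ = a * θ₂ + b := by exact_mod_cast hab
  have hcd' : (θ : ℂ) = c * θ₂ + d := by exact_mod_cast hcd
  refine ⟨n * a + k * c, ?_⟩
  rw [qexp, ← Complex.exp_sub, ← Complex.exp_int_mul, Complex.exp_eq_exp_iff_exists_int]
  refine ⟨n * b + k * d, ?_⟩
  push_cast
  linear_combination (θ : ℂ) * hk + 2 * Real.pi * Complex.I * n * hab' +
    2 * Real.pi * Complex.I * k * hcd'
end

section
/- Let θ₁, θ₂, θ ∈ ℝ and suppose that for all nonzero complex numbers x, x', y, y', if x'/x ∈ Γ_{θ₁}, C_θ(x, y) and C_θ(x', y'), then y'/y ∈ Γ_{θ₂}. Then θ ∈ ℤθ₂ + ℤ and θ·θ₁ ∈ ℤθ₂ + ℤ. -/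
theorem mem_Zlat_of_qexp_mem_Gam {α β : ℝ} (h : qexp β ∈ Gam α) : β ∈ Zlat α := by
  obtain ⟨m, hm⟩ := h
  rw [qexp, qexp, ← Complex.exp_int_mul, Complex.exp_eq_exp_iff_exists_int] at hm
  obtain ⟨n, hn⟩ := hm
  refine ⟨m, n, ?_⟩
  have key : (2 * (Real.pi : ℂ) * Complex.I) * (β : ℂ) =
      (2 * (Real.pi : ℂ) * Complex.I) * ((m : ℂ) * α + n) := by
    rw [hn]
    ring
  exact_mod_cast mul_left_cancel₀ Complex.two_pi_I_ne_zero key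

theorem Crel_qexp (θ a : ℝ) : Crel θ (qexp a) (qexp (θ * a)) :=
  ⟨_, rfl, by rw [qexp]; congr 1; push_cast; ring⟩

theorem stmt4 (θ₁ θ₂ θ : ℝ)
    (h : ∀ x x' y y' : ℂ, x ≠ 0 → x' ≠ 0 → y ≠ 0 → y' ≠ 0 →
      x' / x ∈ Gam θ₁ → Crel θ x y → Crel θ x' y' → y' / y ∈ Gam θ₂) :
    θ ∈ Zlat θ₂ ∧ θ * θ₁ ∈ Zlat θ₂ := by
  have key (a : ℝ) (ha : qexp a ∈ Gam θ₁) : θ * a ∈ Zlat θ₂ := by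
    have hC : Crel θ 1 1 := ⟨0, by simp, by simp⟩
    have hmem := h 1 (qexp a) 1 (qexp (θ * a)) one_ne_zero (Complex.exp_ne_zero _) one_ne_zero
      (Complex.exp_ne_zero _) (by simpa using ha) hC (Crel_qexp θ a)
    exact mem_Zlat_of_qexp_mem_Gam (by simpa using hmem)
  refine ⟨?_, key θ₁ ⟨1, by simp⟩⟩
  simpa using key 1 ⟨0, by simp [qexp, Complex.exp_two_pi_mul_I]⟩
end

section
/- Let θ₁, θ₂ ∈ ℝ with θ₂ irrational, let θ be a nonzero real number, and let a, b, c, d, a', b', c', d' ∈ ℤ satisfy θ·θ₁ = a·θ₂ + b, θ = c·θ₂ + d, θ₂ = θ·(a'·θ₁ + b'), and 1 = θ·(c'·θ₁ + d'). Then ad − bc = 1 or ad − bc = −1. -/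
/-- An irrational number is a zero of an affine function with integer coefficients only if both
coefficients vanish. -/
theorem Irrational.int_coeffs_eq_zero {x : ℝ} (hx : Irrational x) {m n : ℤ}
    (h : (m : ℝ) * x + n = 0) : m = 0 ∧ n = 0 := by
  have hm : m = 0 := by
    by_contra hm
    exact ((hx.intCast_mul hm).add_intCast n).ne_zero h
  subst hm
  exact ⟨rfl, by simpa using h⟩

theorem stmt7 (θ₁ θ₂ θ : ℝ) (h2 : Irrational θ₂) (hθ : θ ≠ 0)
    (a b c d a' b' c' d' : ℤ)
    (e1 : θ * θ₁ = (a : ℝ) * θ₂ + (b : ℝ))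
    (e2 : θ = (c : ℝ) * θ₂ + (d : ℝ))
    (e3 : θ₂ = θ * ((a' : ℝ) * θ₁ + (b' : ℝ)))
    (e4 : (1 : ℝ) = θ * ((c' : ℝ) * θ₁ + (d' : ℝ))) :
    a * d - b * c = 1 ∨ a * d - b * c = -1 := by
  obtain ⟨h₁, h₂⟩ := h2.int_coeffs_eq_zero
    (m := a' * a + b' * c - 1) (n := a' * b + b' * d) (by
      push_cast
      linear_combination -e3 - (a' : ℝ) * e1 - (b' : ℝ) * e2)
  obtain ⟨h₃, h₄⟩ := h2.int_coeffs_eq_zero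
    (m := c' * a + d' * c) (n := c' * b + d' * d - 1) (by
      push_cast
      linear_combination -e4 - (c' : ℝ) * e1 - (d' : ℝ) * e2)
  have hdet : (a * d - b * c) * (a' * d' - b' * c') = 1 := by
    linear_combination (c' * b + d' * d) * h₁ + h₄ - (c' * a + d' * c) * h₂
  exact Int.isUnit_iff.mp (IsUnit.of_mul_eq_one _ hdet)
end

section
/- Let θ ∈ ℝ and let a, b, c, d ∈ ℤ with |ad − bc| = 1 and c·θ + d ≠ 0, and set Θ = (a·θ + b)/(c·θ + d). Then for all nonzero complex numbers x, y: C_Θ(x, y) holds if and only if C_θ(y^c · x^{−a}, x^b · y^{−d}) holds. (In particular, the relation y = x^Θ is positive quantifier-free definable from the relation y = x^θ in the field ℂ.) -/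
/-- A symmetric parametrisation of the relation `y = x^(p/q)`. -/
lemma Crel_div_iff {p q : ℝ} (hq : q ≠ 0) (x y : ℂ) :
    Crel (p / q) x y ↔
      ∃ w : ℂ, x = Complex.exp ((q : ℂ) * w) ∧ y = Complex.exp ((p : ℂ) * w) := by
  have hq' : (q : ℂ) ≠ 0 := by exact_mod_cast hq
  constructor
  · rintro ⟨z, rfl, rfl⟩
    refine ⟨z / q, ?_, ?_⟩
    · congr 1
      field_simp
    · congr 1
      push_cast
      field_simp
  · rintro ⟨w, rfl, rfl⟩
    refine ⟨q * w, rfl, ?_⟩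
    congr 1
    push_cast
    field_simp

/-- An integral monomial in two exponentials is the exponential of a linear form. -/
lemma exp_zpow_mul_exp_zpow (s t : ℂ) (m n : ℤ) :
    Complex.exp s ^ m * Complex.exp t ^ n = Complex.exp (m * s + n * t) := by
  rw [Complex.exp_add, Complex.exp_int_mul, Complex.exp_int_mul]

/-- The monomial substitution with exponent matrix `(-a, c; b, -d)` is inverted by its adjugate,
up to the determinant. -/
lemma zpow_monomial_adjugate {x y : ℂ} (hx : x ≠ 0) (hy : y ≠ 0) (a b c d : ℤ) :
    (y ^ c * x ^ (-a)) ^ (-d) * (x ^ b * y ^ (-d)) ^ (-c) = x ^ (a * d - b * c) ∧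
      (y ^ c * x ^ (-a)) ^ (-b) * (x ^ b * y ^ (-d)) ^ (-a) = y ^ (a * d - b * c) := by
  rw [← Complex.exp_log hx, ← Complex.exp_log hy]
  simp only [exp_zpow_mul_exp_zpow]
  simp only [← Complex.exp_int_mul]
  constructor <;> congr 1 <;> push_cast <;> ring

theorem stmt8 (θ : ℝ) (a b c d : ℤ) (hdet : |a * d - b * c| = 1)
    (hden : (c : ℝ) * θ + (d : ℝ) ≠ 0) :
    ∀ x y : ℂ, x ≠ 0 → y ≠ 0 →
      (Crel (((a : ℝ) * θ + (b : ℝ)) / ((c : ℝ) * θ + (d : ℝ))) x y ↔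
        Crel θ (y ^ (c : ℤ) * x ^ (-a : ℤ)) (x ^ (b : ℤ) * y ^ (-d : ℤ))) := by
  intro x y hx hy
  rw [Crel_div_iff hden]
  constructor
  · rintro ⟨w, rfl, rfl⟩
    refine ⟨(b * c - a * d) * w, ?_, ?_⟩ <;> rw [exp_zpow_mul_exp_zpow] <;> congr 1 <;>
      push_cast <;> ring
  · rintro ⟨v, hu, ht⟩
    obtain ⟨h₁, h₂⟩ := zpow_monomial_adjugate hx hy a b c d
    rw [hu, ht, exp_zpow_mul_exp_zpow] at h₁ h₂
    rcases (abs_eq zero_le_one).1 hdet with h | h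
    · rw [h, zpow_one] at h₁ h₂
      refine ⟨-v, ?_, ?_⟩
      · rw [← h₁]
        congr 1
        push_cast
        ring
      · rw [← h₂]
        congr 1
        push_cast
        ring
    · rw [h, zpow_neg_one] at h₁ h₂
      refine ⟨v, ?_, ?_⟩
      · rw [← inv_inj, ← h₁, ← Complex.exp_neg]
        congr 1
        push_cast
        ring
      · rw [← inv_inj, ← h₂, ← Complex.exp_neg]
        congr 1
        push_cast
        ring
end

section
/- Let θ ∈ ℝ and m, n ∈ ℤ with mθ + n ≠ 0. Then for all nonzero complex numbers x, y: if C_{1/(mθ+n)}(x, y) holds then C_θ(y^m, x·y^{−n}) holds. -/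
theorem stmt12 (θ : ℝ) (m n : ℤ) (h : (m : ℝ) * θ + (n : ℝ) ≠ 0) :
    ∀ x y : ℂ, x ≠ 0 → y ≠ 0 →
      Crel (1 / ((m : ℝ) * θ + (n : ℝ))) x y → Crel θ (y ^ (m : ℤ)) (x * y ^ (-n : ℤ)) := by
  rintro _ _ - - ⟨z, rfl, rfl⟩
  have hc : (m : ℂ) * (θ : ℂ) + (n : ℂ) ≠ 0 := by exact_mod_cast h
  refine ⟨m * (((1 / ((m : ℝ) * θ + (n : ℝ)) : ℝ) : ℂ) * z), (Complex.exp_int_mul _ m).symm, ?_⟩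
  rw [← Complex.exp_int_mul, ← Complex.exp_add]
  congr 1
  push_cast
  field_simp
  ring
end
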